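/- Let p, q, n be positive integers with 2n < p and 2n < q. Let R = ℂ[a_{k,i}, b_{l,j} : 1 ≤ k ≤ p, 1 ≤ l ≤ q, 1 ≤ i,j ≤ n] and let J ⊆ R be the ideal generated by the polynomials ∑_{k=1}^p a_{k,i} a_{k,j} and ∑_{l=1}^q b_{l,i} b_{l,j} for 1 ≤ i ≤ j ≤ n. The group GL_n(ℂ) acts on R by ℂ-algebra automorphisms via the substitution corresponding to (A,B) ↦ (Agᵀ, Bg^{−1}); this action preserves J and hence induces an action on the quotient ring R/J. Then the subring (R/J)^{GL_n(ℂ)} of GL_n(ℂ)-invariants is an integrally closed integral domain. (That is, the closure of the nilpotent K_C-orbit θ({0}) lifted from the trivial orbit, whose coordinate ring is ℂ[N]^{K'_C}, is a normal variety.) -/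

import Mathlib

open MvPolynomial
open scoped MatrixGroups

/-- The ideal `J` of the null cone `N = {(A,B) : AᵀA = 0, BᵀB = 0}` in the
polynomial ring of the matrix entries of `A ∈ M_{p,n}(ℂ)`, `B ∈ M_{q,n}(ℂ)`. -/
noncomputable def nullConeIdealOSp (p q n : ℕ) :
    Ideal (MvPolynomial ((Fin p × Fin n) ⊕ (Fin q × Fin n)) ℂ) :=
  Ideal.span
    ({f | ∃ i j : Fin n, i ≤ j ∧
        f = ∑ k : Fin p, X (Sum.inl (k, i)) * X (Sum.inl (k, j))} ∪
     {f | ∃ i j : Fin n, i ≤ j ∧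
        f = ∑ l : Fin q, X (Sum.inr (l, i)) * X (Sum.inr (l, j))})

/-- The action of `g ∈ GL_n(ℂ)` on the polynomial ring by the substitution
corresponding to `(A,B) ↦ (Agᵀ, Bg⁻¹)`:
`a_{k,i} ↦ ∑_j g_{i,j} a_{k,j}` and `b_{l,i} ↦ ∑_j (g⁻¹)_{j,i} b_{l,j}`. -/
noncomputable def glSubstAction (p q n : ℕ) (g : GL (Fin n) ℂ) :
    MvPolynomial ((Fin p × Fin n) ⊕ (Fin q × Fin n)) ℂ →ₐ[ℂ]
      MvPolynomial ((Fin p × Fin n) ⊕ (Fin q × Fin n)) ℂ :=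
  aeval fun v =>
    match v with
    | Sum.inl (k, i) =>
        ∑ j : Fin n, C ((g : Matrix (Fin n) (Fin n) ℂ) i j) * X (Sum.inl (k, j))
    | Sum.inr (l, i) =>
        ∑ j : Fin n, C (((g⁻¹ : GL (Fin n) ℂ) : Matrix (Fin n) (Fin n) ℂ) j i) *
          X (Sum.inr (l, j))

/-- The subalgebra of elements fixed by a family of algebra endomorphisms
indexed by `GL_n(ℂ)`. -/
def fixedSubalgebra {Q : Type*} [CommRing Q] [Algebra ℂ Q] (n : ℕ)
    (bar : GL (Fin n) ℂ → (Q →ₐ[ℂ] Q)) : Subalgebra ℂ Q where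
  carrier := {x | ∀ g, bar g x = x}
  mul_mem' := fun hx hy g => by rw [map_mul, hx g, hy g]
  one_mem' := fun g => map_one (bar g)
  add_mem' := fun hx hy g => by rw [map_add, hx g, hy g]
  zero_mem' := fun g => map_zero (bar g)
  algebraMap_mem' := fun c g => (bar g).commutes c

/-! ### Polynomials with pairwise coprime leading monomials -/

section CoprimeLeading

variable {σ k ι : Type*} [CommRing k]

/-- The polynomials all of whose monomials have weight less than `d`. -/
noncomputable def weightLT (k : Type*) [CommRing k] (wt : (σ →₀ ℕ) →+ ℕ) (d : ℕ) :
    Submodule k (MvPolynomial σ k) :=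
  restrictSupport k {μ | wt μ < d}

/-- The polynomials none of whose monomials is divisible by some `m i` with `i ∈ s`. -/
noncomputable def reducedPolys (k : Type*) [CommRing k] (m : ι → σ →₀ ℕ) (s : Set ι) :
    Submodule k (MvPolynomial σ k) :=
  restrictSupport k {μ | ∀ i ∈ s, ¬ m i ≤ μ}

lemma mem_weightLT {wt : (σ →₀ ℕ) →+ ℕ} {d : ℕ} {f : MvPolynomial σ k} :
    f ∈ weightLT k wt d ↔ ∀ μ, coeff μ f ≠ 0 → wt μ < d := by
  simp [weightLT, mem_restrictSupport_iff, Set.subset_def]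

lemma mem_reducedPolys {m : ι → σ →₀ ℕ} {s : Set ι} {f : MvPolynomial σ k} :
    f ∈ reducedPolys k m s ↔ ∀ μ, coeff μ f ≠ 0 → ∀ i ∈ s, ¬ m i ≤ μ := by
  simp [reducedPolys, mem_restrictSupport_iff, Set.subset_def]

lemma weightLT_mono {wt : (σ →₀ ℕ) →+ ℕ} {d e : ℕ} (h : d ≤ e) :
    weightLT k wt d ≤ weightLT k wt e :=
  restrictSupport_mono _ fun _ hμ => lt_of_lt_of_le hμ h

lemma mul_mem_weightLT {wt : (σ →₀ ℕ) →+ ℕ} {d e : ℕ} {f g : MvPolynomial σ k}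
    (hf : f ∈ weightLT k wt (d + 1)) (hg : g ∈ weightLT k wt e) :
    f * g ∈ weightLT k wt (d + e) := by
  classical
  rw [mem_weightLT] at hf hg ⊢
  intro μ hμ
  obtain ⟨a, ha, b, hb, rfl⟩ := Finset.mem_add.mp (support_mul f g (mem_support_iff.mpr hμ))
  have := hf a (mem_support_iff.mp ha)
  have := hg b (mem_support_iff.mp hb)
  rw [map_add]
  omega

lemma exists_mem_weightLT (wt : (σ →₀ ℕ) →+ ℕ) (f : MvPolynomial σ k) :
    ∃ d, f ∈ weightLT k wt d := by
  refine ⟨f.support.sup wt + 1, mem_weightLT.mpr fun μ hμ => ?_⟩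
  exact Nat.lt_succ_of_le (Finset.le_sup (f := wt) (mem_support_iff.mpr hμ))

variable (wt : (σ →₀ ℕ) →+ ℕ) (m : ι → σ →₀ ℕ) (h : ι → MvPolynomial σ k)

lemma weightLT_le_reduced_sup (hm : ∀ i, h i - monomial (m i) 1 ∈ weightLT k wt (wt (m i)))
    (s : Set ι) (d : ℕ) :
    weightLT k wt d ≤ (weightLT k wt d ⊓ reducedPolys k m s) ⊔
      (Ideal.span (h '' s)).restrictScalars k := by
  induction d using Nat.strong_induction_on with
  | _ d ih =>
  conv_lhs => rw [weightLT, restrictSupport_eq_span]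
  rw [Submodule.span_le]
  rintro _ ⟨μ, hμ, rfl⟩
  replace hμ : wt μ < d := hμ
  by_cases hr : ∀ i ∈ s, ¬ m i ≤ μ
  · exact Submodule.mem_sup_left ⟨(monomial_mem_restrictSupport _).mpr (Or.inl hμ),
      (monomial_mem_restrictSupport _).mpr (Or.inl hr)⟩
  · push Not at hr
    obtain ⟨i, hi, hle⟩ := hr
    have key : (monomial μ 1 : MvPolynomial σ k) =
        -(monomial (μ - m i) 1 * (h i - monomial (m i) 1)) + monomial (μ - m i) 1 * h i := by
      rw [mul_sub, monomial_mul, tsub_add_cancel_of_le hle]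
      simp
    simp only
    rw [key]
    have hwt : wt (μ - m i) + wt (m i) = wt μ := by
      rw [← map_add, tsub_add_cancel_of_le hle]
    refine Submodule.add_mem _ (Submodule.neg_mem _ ?_) (Submodule.mem_sup_right ?_)
    · refine sup_le_sup_right (inf_le_inf_right _ (weightLT_mono hμ.le)) _ (ih (wt μ) hμ ?_)
      rw [← hwt]
      exact mul_mem_weightLT ((monomial_mem_restrictSupport _).mpr (Or.inl (Nat.lt_succ_self _))) (hm i)
    · exact Ideal.mul_mem_left _ _ (Ideal.subset_span ⟨i, hi, rfl⟩)

lemma exists_reduced_sub_mem (hm : ∀ i, h i - monomial (m i) 1 ∈ weightLT k wt (wt (m i)))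
    (s : Set ι) (f : MvPolynomial σ k) :
    ∃ g ∈ reducedPolys k m s, f - g ∈ Ideal.span (h '' s) := by
  obtain ⟨d, hd⟩ := exists_mem_weightLT wt f
  obtain ⟨g, hg, r, hr, rfl⟩ := Submodule.mem_sup.mp (weightLT_le_reduced_sup wt m h hm s d hd)
  exact ⟨g, hg.2, by simpa using hr⟩

lemma le_of_le_add_of_disjoint {a b c : σ →₀ ℕ} (hd : Disjoint a.support b.support)
    (hle : a ≤ c + b) : a ≤ c := by
  intro x
  by_cases hx : a x = 0
  · simp [hx]
  · have : b x = 0 := by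
      simpa using Finset.disjoint_left.mp hd (Finsupp.mem_support_iff.mpr hx)
    simpa [this] using hle x

/-- The top-weight monomials of an element of the ideal spanned by the `h i` are divisible by
some `m i`. -/
lemma exists_le_of_mem_span
    (hm : ∀ i, h i - monomial (m i) 1 ∈ weightLT k wt (wt (m i)))
    (hdis : ∀ i j, i ≠ j → Disjoint (m i).support (m j).support) (s : Finset ι) :
    ∀ f ∈ Ideal.span (h '' (s : Set ι)), ∀ μ, f ∈ weightLT k wt (wt μ + 1) → coeff μ f ≠ 0 →
      ∃ i ∈ s, m i ≤ μ := by
  classical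
  induction s using Finset.induction_on with
  | empty =>
    intro f hf μ _ hc
    simp only [Finset.coe_empty, Set.image_empty, Ideal.span_empty, Ideal.mem_bot] at hf
    simp [hf] at hc
  | insert a s has ih =>
    intro f hf μ hfw hc
    rw [Finset.coe_insert, Set.image_insert_eq, Ideal.mem_span_insert] at hf
    obtain ⟨c₀, u₀, hu₀, rfl⟩ := hf
    obtain ⟨c, hcr, hcs⟩ := exists_reduced_sub_mem wt m h hm s c₀
    obtain ⟨u, hu, hfu⟩ : ∃ u ∈ Ideal.span (h '' (s : Set ι)), c₀ * h a + u₀ = c * h a + u :=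
      ⟨(c₀ - c) * h a + u₀, Ideal.add_mem _ (Ideal.mul_mem_right _ _ hcs) hu₀, by ring⟩
    rw [hfu] at hfw hc
    clear hfu
    have hsplit : c * h a = c * monomial (m a) 1 + c * (h a - monomial (m a) 1) := by ring
    have hnot : ∀ ν, coeff ν c ≠ 0 → ∀ i ∈ s, ¬ m i ≤ ν + m a := by
      intro ν hν i hi hle
      refine mem_reducedPolys.mp hcr ν hν i hi (le_of_le_add_of_disjoint (hdis i a ?_) hle)
      rintro rfl
      exact has hi
    by_contra hno
    push Not at hno
    have hno_s : ∀ i ∈ s, ¬ m i ≤ μ := fun i hi => hno i (Finset.mem_insert_of_mem hi)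
    have hno_a : ¬ m a ≤ μ := hno a (Finset.mem_insert_self _ _)
    by_cases hc0 : c = 0
    · subst hc0
      rw [zero_mul, zero_add] at hfw hc
      obtain ⟨i, hi, hle⟩ := ih u hu μ hfw hc
      exact hno_s i hi hle
    obtain ⟨ν, hν, hmax⟩ := Finset.exists_max_image c.support wt
      (Finset.nonempty_iff_ne_empty.mpr (by simpa using hc0))
    rw [mem_support_iff] at hν
    have hcw : c ∈ weightLT k wt (wt ν + 1) :=
      mem_weightLT.mpr fun τ hτ => Nat.lt_succ_of_le (hmax τ (mem_support_iff.mpr hτ))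
    have hlow : c * (h a - monomial (m a) 1) ∈ weightLT k wt (wt (ν + m a)) := by
      rw [map_add]; exact mul_mem_weightLT hcw (hm a)
    have hmul : c * monomial (m a) 1 ∈ weightLT k wt (wt (ν + m a) + 1) := by
      rw [map_add, add_assoc]
      exact mul_mem_weightLT hcw ((monomial_mem_restrictSupport _).mpr (Or.inl (Nat.lt_succ_self _)))
    have hall : c * h a ∈ weightLT k wt (wt (ν + m a) + 1) := by
      rw [hsplit]
      exact Submodule.add_mem _ hmul (weightLT_mono (Nat.le_succ _) hlow)
    have hle : wt (ν + m a) ≤ wt μ := by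
      by_contra hlt
      push Not at hlt
      have hcν : coeff (ν + m a) (c * h a) ≠ 0 := by
        have h0 : coeff (ν + m a) (c * (h a - monomial (m a) 1)) = 0 := by
          by_contra hne
          exact lt_irrefl _ (mem_weightLT.mp hlow _ hne)
        rw [hsplit, coeff_add, h0, coeff_mul_monomial]
        simpa using hν
      have hzero : coeff (ν + m a) (c * h a + u) = 0 := by
        by_contra hne
        have := mem_weightLT.mp hfw _ hne
        omega
      have huν : coeff (ν + m a) u ≠ 0 := by
        intro h0
        rw [coeff_add, h0, add_zero] at hzero
        exact hcν hzero
      have huw : u ∈ weightLT k wt (wt (ν + m a) + 1) := by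
        have : u = (c * h a + u) - c * h a := by ring
        rw [this]
        exact Submodule.sub_mem _ (weightLT_mono (by omega) hfw) hall
      obtain ⟨i, hi, hil⟩ := ih u hu _ huw huν
      exact hnot ν hν i hi hil
    have huw : u ∈ weightLT k wt (wt μ + 1) := by
      have : u = (c * h a + u) - c * h a := by ring
      rw [this]
      exact Submodule.sub_mem _ hfw (weightLT_mono (by omega) hall)
    have hu0 : coeff μ u = 0 := by
      by_contra hne
      obtain ⟨i, hi, hil⟩ := ih u hu μ huw hne
      exact hno_s i hi hil
    have hl0 : coeff μ (c * (h a - monomial (m a) 1)) = 0 := by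
      by_contra hne
      have := mem_weightLT.mp hlow _ hne
      omega
    rw [coeff_add, hu0, hsplit, coeff_add, hl0, coeff_mul_monomial', if_neg hno_a] at hc
    simp at hc

lemma eq_zero_of_reduced_of_mem_span [Fintype ι]
    (hm : ∀ i, h i - monomial (m i) 1 ∈ weightLT k wt (wt (m i)))
    (hdis : ∀ i j, i ≠ j → Disjoint (m i).support (m j).support)
    {f : MvPolynomial σ k} (hr : f ∈ reducedPolys k m Set.univ)
    (hf : f ∈ Ideal.span (Set.range h)) : f = 0 := by
  by_contra hne
  obtain ⟨μ, hμ, hmax⟩ := Finset.exists_max_image f.support wt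
    (Finset.nonempty_iff_ne_empty.mpr (by simpa using hne))
  rw [mem_support_iff] at hμ
  obtain ⟨i, -, hi⟩ := exists_le_of_mem_span wt m h hm hdis Finset.univ f (by simpa using hf) μ
    (mem_weightLT.mpr fun τ hτ => Nat.lt_succ_of_le (hmax τ (mem_support_iff.mpr hτ))) hμ
  exact mem_reducedPolys.mp hr μ hμ i trivial hi

lemma X_mul_mem_reducedPolys {a : σ} (ha : ∀ i, m i a = 0) {f : MvPolynomial σ k}
    (hr : f ∈ reducedPolys k m Set.univ) : X a * f ∈ reducedPolys k m Set.univ := by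
  classical
  rw [mem_reducedPolys] at hr ⊢
  intro μ hμ i hi hle
  rw [coeff_X_mul'] at hμ
  split_ifs at hμ with hμa
  · refine hr _ hμ i hi fun b => ?_
    by_cases hb : b = a
    · subst hb; simp [ha]
    · simpa [Finsupp.single_apply, Ne.symm hb] using hle b
  · exact hμ rfl

lemma exists_reduced_mk_eq
    (hm : ∀ i, h i - monomial (m i) 1 ∈ weightLT k wt (wt (m i)))
    (u : MvPolynomial σ k ⧸ Ideal.span (Set.range h)) :
    ∃ f ∈ reducedPolys k m Set.univ, Ideal.Quotient.mk _ f = u := by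
  obtain ⟨f, rfl⟩ := Ideal.Quotient.mk_surjective u
  obtain ⟨g, hg, hfg⟩ := exists_reduced_sub_mem wt m h hm Set.univ f
  rw [Set.image_univ] at hfg
  exact ⟨g, hg, (Ideal.Quotient.eq.mpr hfg).symm⟩

/-- A variable not occurring in any leading monomial is a nonzerodivisor on the quotient. -/
lemma mk_X_mul_eq_zero [Fintype ι]
    (hm : ∀ i, h i - monomial (m i) 1 ∈ weightLT k wt (wt (m i)))
    (hdis : ∀ i j, i ≠ j → Disjoint (m i).support (m j).support)
    {a : σ} (ha : ∀ i, m i a = 0)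
    (u : MvPolynomial σ k ⧸ Ideal.span (Set.range h))
    (hu : Ideal.Quotient.mk _ (X a) * u = 0) : u = 0 := by
  obtain ⟨f, hf, rfl⟩ := exists_reduced_mk_eq wt m h hm u
  rw [← map_mul, Ideal.Quotient.eq_zero_iff_mem] at hu
  have h0 := eq_zero_of_reduced_of_mem_span wt m h hm hdis (X_mul_mem_reducedPolys m ha hf) hu
  have : f = 0 := by
    ext μ
    have := congrArg (coeff (Finsupp.single a 1 + μ)) h0
    rwa [coeff_X_mul] at this
  rw [this, map_zero]

/-- Two distinct variables not occurring in any leading monomial form a regular sequence on the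
quotient. -/
lemma mk_X_dvd_of_mk_X_mul_eq [Fintype ι]
    (hm : ∀ i, h i - monomial (m i) 1 ∈ weightLT k wt (wt (m i)))
    (hdis : ∀ i j, i ≠ j → Disjoint (m i).support (m j).support)
    {a b : σ} (hab : a ≠ b) (ha : ∀ i, m i a = 0)
    (hb : ∀ i, m i b = 0) (u v : MvPolynomial σ k ⧸ Ideal.span (Set.range h))
    (huv : Ideal.Quotient.mk _ (X b) * u = Ideal.Quotient.mk _ (X a) * v) :
    Ideal.Quotient.mk _ (X a) ∣ u := by
  obtain ⟨f, hf, rfl⟩ := exists_reduced_mk_eq wt m h hm u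
  obtain ⟨g, hg, rfl⟩ := exists_reduced_mk_eq wt m h hm v
  rw [← map_mul, ← map_mul, Ideal.Quotient.eq] at huv
  have h0 := eq_zero_of_reduced_of_mem_span wt m h hm hdis
    (Submodule.sub_mem _ (X_mul_mem_reducedPolys m hb hf) (X_mul_mem_reducedPolys m ha hg)) huv
  refine map_dvd _ (X_dvd_iff_modMonomial_eq_zero.mpr ?_)
  classical
  ext μ
  rw [coeff_zero]
  by_cases hle : Finsupp.single a 1 ≤ μ
  · exact coeff_modMonomial_of_le f hle
  · rw [coeff_modMonomial_of_not_le f hle]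
    have := congrArg (coeff (Finsupp.single b 1 + μ)) (sub_eq_zero.mp h0)
    rw [coeff_X_mul, coeff_X_mul', if_neg] at this
    · exact this
    · have : μ a = 0 := by
        by_contra hne
        exact hle (Finsupp.single_le_iff.mpr (Nat.one_le_iff_ne_zero.mpr hne))
      simp [this, hab.symm]

end CoprimeLeading

/-! ### The null cone of a split quadratic form -/

section NullRing

/-- Coordinates of a quadratic space: `n` hyperbolic planes and `r + 1` orthonormal vectors. -/
abbrev Coord (n r : ℕ) : Type := Fin n ⊕ Fin n ⊕ Fin (r + 1)

/-- The symmetric bilinear form `∑ (x_k y'_k + y_k x'_k) + ∑ z_l z'_l`. -/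
def splitForm {B : Type*} [CommRing B] {n r : ℕ} (v w : Coord n r → B) : B :=
  ∑ k : Fin n, (v (Sum.inl k) * w (Sum.inr (Sum.inl k)) +
    v (Sum.inr (Sum.inl k)) * w (Sum.inl k)) +
  ∑ l : Fin (r + 1), v (Sum.inr (Sum.inr l)) * w (Sum.inr (Sum.inr l))

/-- The defining equations of the null cone of `n` vectors, indexed by pairs `i ≤ j`. -/
noncomputable def nullEqn (k : Type*) [CommRing k] (n r : ℕ)
    (e : {e : Fin n × Fin n // e.1 ≤ e.2}) : MvPolynomial (Fin n × Coord n r) k :=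
  splitForm (fun c => X (e.1.1, c)) (fun c => X (e.1.2, c))

/-- The coordinate ring of the scheme of `n` pairwise orthogonal isotropic vectors. -/
abbrev NullRing (k : Type*) [CommRing k] (n r : ℕ) : Type _ :=
  MvPolynomial (Fin n × Coord n r) k ⧸ Ideal.span (Set.range (nullEqn k n r))

/-- The weights making `nullLead` the leading monomials of `nullEqn`. -/
def nullWeight (n r : ℕ) : Fin n × Coord n r → ℕ
  | (i, Sum.inl a) => if (a : ℕ) = 0 then 4 * n ^ 2 else 4 * n ^ 2 + 1 - a ^ 2 - 2 * a * i
  | (i, Sum.inr (Sum.inl a)) => 4 * n ^ 2 + 1 + 2 * a * i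
  | (_, Sum.inr (Sum.inr l)) => if l = 0 then 4 * n ^ 2 + 1 else 4 * n ^ 2

/-- The leading monomials: `z_{0,i} ^ 2` for `i = j` and `x_{j-i,i} y_{j-i,j}` for `i < j`. -/
noncomputable def nullLead (n r : ℕ) (e : {e : Fin n × Fin n // e.1 ≤ e.2}) :
    Fin n × Coord n r →₀ ℕ :=
  let a : Fin n := ⟨e.1.2 - e.1.1, by omega⟩
  if e.1.1 = e.1.2 then
    Finsupp.single (e.1.1, Sum.inr (Sum.inr 0)) 1 + Finsupp.single (e.1.1, Sum.inr (Sum.inr 0)) 1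
  else Finsupp.single (e.1.1, Sum.inl a) 1 + Finsupp.single (e.1.2, Sum.inr (Sum.inl a)) 1

variable {n r : ℕ}

lemma eq_of_nullLead_ne_zero {e : {e : Fin n × Fin n // e.1 ≤ e.2}} {v : Fin n × Coord n r}
    (h : nullLead n r e v ≠ 0) :
    (e.1.1 = e.1.2 ∧ v = (e.1.1, Sum.inr (Sum.inr 0))) ∨
    ∃ a : Fin n, 0 < (a : ℕ) ∧ (a : ℕ) + e.1.1 = e.1.2 ∧
      (v = (e.1.1, Sum.inl a) ∨ v = (e.1.2, Sum.inr (Sum.inl a))) := by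
  classical
  have hle : (e.1.1 : ℕ) ≤ e.1.2 := e.2
  unfold nullLead at h
  split_ifs at h with hij
  · refine Or.inl ⟨hij, ?_⟩
    by_contra hv
    simp [Ne.symm hv] at h
  · have hij' : (e.1.1 : ℕ) ≠ e.1.2 := fun h' => hij (Fin.ext h')
    refine Or.inr ⟨⟨e.1.2 - e.1.1, by omega⟩, by simp only; omega, by simp only; omega, ?_⟩
    by_contra hv
    push Not at hv
    simp [Ne.symm hv.1, Ne.symm hv.2] at h

lemma disjoint_support_nullLead (e e' : {e : Fin n × Fin n // e.1 ≤ e.2}) (hne : e ≠ e') :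
    Disjoint (nullLead n r e).support (nullLead n r e').support := by
  rw [Finset.disjoint_left]
  intro v hv hv'
  rw [Finsupp.mem_support_iff] at hv hv'
  apply hne
  obtain ⟨⟨i, j⟩, hij⟩ := e
  obtain ⟨⟨i', j'⟩, hij'⟩ := e'
  simp only [Subtype.mk.injEq, Prod.mk.injEq, Fin.ext_iff]
  rcases eq_of_nullLead_ne_zero hv with ⟨h1, rfl⟩ | ⟨a, ha, haij, rfl | rfl⟩ <;>
  rcases eq_of_nullLead_ne_zero hv' with ⟨h2, h3⟩ | ⟨b, hb, hbij, h3 | h3⟩ <;>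
  simp only [Prod.mk.injEq, Sum.inl.injEq, Sum.inr.injEq, Fin.ext_iff, reduceCtorEq, and_false]
    at * <;> omega

lemma X_mul_X_mem_weightLT {σ k : Type*} [CommRing k] {w : σ → ℕ} {a b : σ} {d : ℕ}
    (h : w a + w b < d) :
    (X a * X b : MvPolynomial σ k) ∈ weightLT k (Finsupp.weight w) d := by
  rw [X, X, monomial_mul]
  refine (monomial_mem_restrictSupport _).mpr (Or.inl ?_)
  simpa [Finsupp.weight_single] using h

lemma nullWeight_x_le (i a : Fin n) :
    (nullWeight n r (i, Sum.inl a) : ℤ) ≤ 4 * n ^ 2 + 1 - a ^ 2 - 2 * a * i ∧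
    ((a : ℕ) = 0 → (nullWeight n r (i, Sum.inl a) : ℤ) = 4 * n ^ 2) ∧
    (0 < (a : ℕ) → (nullWeight n r (i, Sum.inl a) : ℤ) = 4 * n ^ 2 + 1 - a ^ 2 - 2 * a * i) := by
  have h : (a : ℕ) ^ 2 + 2 * a * i ≤ 4 * n ^ 2 := by nlinarith [a.2, i.2]
  have key : (0 < (a : ℕ) →
      (nullWeight n r (i, Sum.inl a) : ℤ) = 4 * n ^ 2 + 1 - a ^ 2 - 2 * a * i) := by
    intro ha
    simp only [nullWeight, if_neg ha.ne']
    zify at h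
    rw [Nat.sub_sub, Nat.cast_sub (by linarith)]
    push_cast
    ring
  have key0 : ((a : ℕ) = 0 → (nullWeight n r (i, Sum.inl a) : ℤ) = 4 * n ^ 2) := by
    intro ha
    simp [nullWeight, ha]
  refine ⟨?_, key0, key⟩
  rcases Nat.eq_zero_or_pos (a : ℕ) with ha | ha
  · rw [key0 ha, ha]; simp
  · exact (key ha).le

lemma nullEqn_sub_lead_mem (k : Type*) [CommRing k] (e : {e : Fin n × Fin n // e.1 ≤ e.2}) :
    nullEqn k n r e - monomial (nullLead n r e) 1 ∈
      weightLT k (Finsupp.weight (nullWeight n r))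
        (Finsupp.weight (nullWeight n r) (nullLead n r e)) := by
  obtain ⟨⟨i, j⟩, hij⟩ := e
  have hy : ∀ i a : Fin n, (nullWeight n r (i, Sum.inr (Sum.inl a)) : ℤ) =
      4 * n ^ 2 + 1 + 2 * a * i := fun i a => by simp [nullWeight]
  have hz : ∀ (i : Fin n) (l : Fin (r + 1)),
      (nullWeight n r (i, Sum.inr (Sum.inr l))) ≤ 4 * n ^ 2 + 1 := fun i l => by
    simp only [nullWeight]; split_ifs <;> omega
  have hz0 : ∀ (i : Fin n), (nullWeight n r (i, Sum.inr (Sum.inr 0))) = 4 * n ^ 2 + 1 :=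
    fun i => by simp [nullWeight]
  by_cases h : i = j
  · subst h
    have hlead : nullLead n r ⟨(i, i), hij⟩ = Finsupp.single (i, Sum.inr (Sum.inr 0)) 1 +
      Finsupp.single (i, Sum.inr (Sum.inr 0)) 1 := by simp [nullLead]
    have hwt : Finsupp.weight (nullWeight n r) (nullLead n r ⟨(i, i), hij⟩) =
        2 * (4 * n ^ 2 + 1) := by
      rw [hlead, map_add, Finsupp.weight_single, hz0]; simp; ring
    rw [hwt, hlead, nullEqn, splitForm, Fin.sum_univ_succ]
    have hmon : (monomial (Finsupp.single (i, Sum.inr (Sum.inr 0)) 1 +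
        Finsupp.single (i, Sum.inr (Sum.inr 0)) 1) 1 : MvPolynomial (Fin n × Coord n r) k) =
        X (i, Sum.inr (Sum.inr 0)) * X (i, Sum.inr (Sum.inr 0)) := by
      rw [X, monomial_mul, one_mul]
    rw [hmon, ← add_assoc, add_right_comm, add_sub_cancel_right]
    have hxy : ∀ a : Fin n, nullWeight n r (i, Sum.inl a) +
        nullWeight n r (i, Sum.inr (Sum.inl a)) < 2 * (4 * n ^ 2 + 1) := by
      intro a
      have h1 := hy i a
      obtain ⟨-, h2, h3⟩ := nullWeight_x_le (r := r) i a
      zify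
      rcases Nat.eq_zero_or_pos (a : ℕ) with ha | ha
      · rw [h1, h2 ha, ha]; simp; linarith
      · rw [h1, h3 ha]
        have : (0 : ℤ) < (a : ℕ) := by exact_mod_cast ha
        nlinarith
    refine Submodule.add_mem _ (Submodule.sum_mem _ fun a _ => Submodule.add_mem _ ?_ ?_)
      (Submodule.sum_mem _ fun l _ => ?_)
    · exact X_mul_X_mem_weightLT (hxy a)
    · exact X_mul_X_mem_weightLT (by rw [add_comm]; exact hxy a)
    · refine X_mul_X_mem_weightLT ?_
      simp only [nullWeight, Fin.succ_ne_zero, if_false]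
      omega
  · have hlt : (i : ℕ) < j := lt_of_le_of_ne hij fun h' => h (Fin.ext h')
    let b : Fin n := ⟨j - i, by omega⟩
    have hb : (b : ℕ) + i = j := by simp only [b]; omega
    have hb0 : 0 < (b : ℕ) := by omega
    have hlead : nullLead n r ⟨(i, j), hij⟩ = Finsupp.single (i, Sum.inl b) 1 +
      Finsupp.single (j, Sum.inr (Sum.inl b)) 1 := by simp [nullLead, h, b]
    have hbz : (j : ℤ) = b + i := by exact_mod_cast hb.symm
    have hb0z : (0 : ℤ) < (b : ℕ) := by exact_mod_cast hb0
    have hwt : ((Finsupp.weight (nullWeight n r) (nullLead n r ⟨(i, j), hij⟩) : ℕ) : ℤ) =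
        2 * (4 * n ^ 2 + 1) + b ^ 2 := by
      rw [hlead, map_add, Finsupp.weight_single, Finsupp.weight_single]
      simp only [one_smul]
      rw [Nat.cast_add, (nullWeight_x_le i b).2.2 hb0, hy, hbz]
      ring
    set d := Finsupp.weight (nullWeight n r) (nullLead n r ⟨(i, j), hij⟩) with hd
    have hmon : (monomial (Finsupp.single (i, Sum.inl b) 1 +
        Finsupp.single (j, Sum.inr (Sum.inl b)) 1) 1 : MvPolynomial (Fin n × Coord n r) k) =
        X (i, Sum.inl b) * X (j, Sum.inr (Sum.inl b)) := by
      rw [X, X, monomial_mul, one_mul]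
    rw [hlead, hmon, nullEqn, splitForm, Finset.sum_add_distrib,
      ← Finset.add_sum_erase _ _ (Finset.mem_univ b), add_assoc, add_assoc, add_sub_cancel_left]
    refine Submodule.add_mem _ (Submodule.sum_mem _ fun a ha => ?_)
      (Submodule.add_mem _ (Submodule.sum_mem _ fun a _ => ?_) (Submodule.sum_mem _ fun l _ => ?_))
    · refine X_mul_X_mem_weightLT ?_
      simp only
      zify
      rw [hwt, hy]
      have hne : (a : ℤ) - (b : ℕ) ≠ 0 := by
        have := Finset.ne_of_mem_erase ha
        rw [Ne, Fin.ext_iff] at this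
        omega
      have hpos : 0 < ((a : ℤ) - (b : ℕ)) ^ 2 := by positivity
      have := (nullWeight_x_le (r := r) i a).1
      rw [hbz]
      nlinarith
    · refine X_mul_X_mem_weightLT ?_
      simp only
      zify
      rw [hwt, hy]
      have := (nullWeight_x_le (r := r) j a).1
      rw [hbz] at this
      have h0 : (0 : ℤ) ≤ (a : ℕ) := by positivity
      nlinarith [mul_nonneg h0 hb0z.le, sq_nonneg ((a : ℕ) : ℤ), pow_pos hb0z 2]
    · refine X_mul_X_mem_weightLT ?_
      simp only
      have h1 := hz i l
      have h2 := hz j l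
      zify at h1 h2 ⊢
      rw [hwt]
      nlinarith [pow_pos hb0z 2]

lemma nullLead_eq_zero (k : Fin n) (hk : (k : ℕ) = 0) (i : Fin n)
    (e : {e : Fin n × Fin n // e.1 ≤ e.2}) :
    nullLead n r e (i, Sum.inl k) = 0 ∧ nullLead n r e (i, Sum.inr (Sum.inl k)) = 0 := by
  constructor
  all_goals
    by_contra hne
    rcases eq_of_nullLead_ne_zero hne with ⟨-, h⟩ | ⟨a, ha, -, h | h⟩
    all_goals
      simp only [Prod.mk.injEq, Sum.inl.injEq, Sum.inr.injEq, Fin.ext_iff, reduceCtorEq, and_false]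
        at h
      try omega

/-- The tautological vectors of the null cone. -/
noncomputable def nullVec (k : Type*) [CommRing k] (n r : ℕ) (i : Fin n) (c : Coord n r) :
    NullRing k n r :=
  Ideal.Quotient.mk _ (X (i, c))

lemma nullVec_x_mul_eq_zero (k : Type*) [CommRing k] (u : NullRing k (n + 1) r)
    (hu : nullVec k (n + 1) r 0 (Sum.inl 0) * u = 0) : u = 0 :=
  mk_X_mul_eq_zero _ _ _ (nullEqn_sub_lead_mem k) disjoint_support_nullLead
    (fun e => (nullLead_eq_zero 0 rfl 0 e).1) u hu

lemma nullVec_x_dvd_of_y_mul_eq (k : Type*) [CommRing k] (u v : NullRing k (n + 1) r)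
    (huv : nullVec k (n + 1) r 0 (Sum.inr (Sum.inl 0)) * u = nullVec k (n + 1) r 0 (Sum.inl 0) * v) :
    nullVec k (n + 1) r 0 (Sum.inl 0) ∣ u :=
  mk_X_dvd_of_mk_X_mul_eq _ _ _ (nullEqn_sub_lead_mem k) disjoint_support_nullLead (by simp)
    (fun e => (nullLead_eq_zero 0 rfl 0 e).1) (fun e => (nullLead_eq_zero 0 rfl 0 e).2) u v huv

lemma splitForm_comm {B : Type*} [CommRing B] (v w : Coord n r → B) :
    splitForm v w = splitForm w v := by
  unfold splitForm
  congr 1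
  · exact Finset.sum_congr rfl fun _ _ => by ring
  · exact Finset.sum_congr rfl fun _ _ => by ring

lemma map_splitForm {B B' : Type*} [CommRing B] [CommRing B'] (f : B →+* B')
    (v w : Coord n r → B) :
    f (splitForm v w) = splitForm (fun c => f (v c)) (fun c => f (w c)) := by
  simp [splitForm]

lemma splitForm_add_mul_left {B : Type*} [CommRing B] (v u w : Coord n r → B) (a : B) :
    splitForm (fun c => v c + a * u c) w = splitForm v w + a * splitForm u w := by
  simp only [splitForm, mul_add, Finset.mul_sum]
  rw [add_add_add_comm, ← Finset.sum_add_distrib, ← Finset.sum_add_distrib]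
  congr 1
  all_goals exact Finset.sum_congr rfl fun _ _ => by ring

lemma splitForm_add_mul_right {B : Type*} [CommRing B] (v u w : Coord n r → B) (a : B) :
    splitForm w (fun c => v c + a * u c) = splitForm w v + a * splitForm w u := by
  rw [splitForm_comm, splitForm_add_mul_left, splitForm_comm v, splitForm_comm u]

lemma splitForm_nullVec (k : Type*) [CommRing k] (i j : Fin n) :
    splitForm (nullVec k n r i) (nullVec k n r j) = 0 := by
  wlog h : i ≤ j generalizing i j
  · rw [splitForm_comm]
    exact this j i (le_of_not_ge h)
  · have : Ideal.Quotient.mk (Ideal.span (Set.range (nullEqn k n r))) (nullEqn k n r ⟨(i, j), h⟩)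
        = 0 := Ideal.Quotient.eq_zero_iff_mem.mpr (Ideal.subset_span ⟨_, rfl⟩)
    rw [nullEqn, map_splitForm] at this
    exact this

/-- The universal property of the null cone. -/
noncomputable def nullLift {k B : Type*} [CommRing k] [CommRing B] (f : k →+* B)
    (V : Fin n → Coord n r → B) (hV : ∀ i j, splitForm (V i) (V j) = 0) :
    NullRing k n r →+* B :=
  Ideal.Quotient.lift _ (eval₂Hom f fun v => V v.1 v.2) fun a ha => by
    have hle : Ideal.span (Set.range (nullEqn k n r)) ≤
        RingHom.ker (eval₂Hom f fun v : Fin n × Coord n r => V v.1 v.2) := by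
      rw [Ideal.span_le]
      rintro _ ⟨e, rfl⟩
      rw [SetLike.mem_coe, RingHom.mem_ker, nullEqn, map_splitForm]
      simpa using hV e.1.1 e.1.2
    exact hle ha

section Lift

variable {k B : Type*} [CommRing k] [CommRing B] (f : k →+* B)
    (V : Fin n → Coord n r → B) (hV : ∀ i j, splitForm (V i) (V j) = 0)

@[simp]
lemma nullLift_nullVec (i : Fin n) (c : Coord n r) :
    nullLift f V hV (nullVec k n r i c) = V i c := by
  exact (Ideal.Quotient.lift_mk _ _ _).trans (by simp)

@[simp]
lemma nullLift_algebraMap (a : k) : nullLift f V hV (algebraMap k (NullRing k n r) a) = f a := by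
  change nullLift f V hV (Ideal.Quotient.mk _ (C a)) = f a
  exact (Ideal.Quotient.lift_mk _ _ _).trans (by simp)

lemma nullRing_induction {P : NullRing k n r → Prop} (hC : ∀ a, P (algebraMap k _ a))
    (hadd : ∀ a b, P a → P b → P (a + b)) (hmul : ∀ a b, P a → P b → P (a * b))
    (hvec : ∀ i c, P (nullVec k n r i c)) (a : NullRing k n r) : P a := by
  obtain ⟨a, rfl⟩ := Ideal.Quotient.mk_surjective a
  induction a using MvPolynomial.induction_on with
  | C a => exact hC a
  | add p q hp hq => rw [map_add]; exact hadd _ _ hp hq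
  | mul_X p v hp => rw [map_mul]; exact hmul _ _ hp (hvec v.1 v.2)

lemma nullRing_hom_ext {g g' : NullRing k n r →+* B}
    (hC : ∀ a, g (algebraMap k _ a) = g' (algebraMap k _ a))
    (hvec : ∀ i c, g (nullVec k n r i c) = g' (nullVec k n r i c)) : g = g' := by
  ext1
  refine MvPolynomial.ringHom_ext (fun a => hC a) fun v => hvec v.1 v.2

end Lift

/-- The involution exchanging the two isotropic halves of the hyperbolic planes. -/
def swapCoord : Coord n r → Coord n r
  | Sum.inl a => Sum.inr (Sum.inl a)
  | Sum.inr (Sum.inl a) => Sum.inl a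
  | Sum.inr (Sum.inr l) => Sum.inr (Sum.inr l)

lemma swapCoord_swapCoord (c : Coord n r) : swapCoord (swapCoord c) = c := by
  rcases c with a | a | l <;> rfl

lemma splitForm_swap {B : Type*} [CommRing B] (v w : Coord n r → B) :
    splitForm (fun c => v (swapCoord c)) (fun c => w (swapCoord c)) = splitForm v w := by
  simp only [splitForm, swapCoord]
  congr 1
  exact Finset.sum_congr rfl fun _ _ => add_comm _ _

/-- The endomorphism of the null cone ring induced by `swapCoord`. -/
noncomputable def nullSwap (k : Type*) [CommRing k] (n r : ℕ) : NullRing k n r →+* NullRing k n r :=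
  nullLift (algebraMap k _) (fun i c => nullVec k n r i (swapCoord c)) fun i j => by
    rw [splitForm_swap, splitForm_nullVec]

lemma nullSwap_nullSwap (k : Type*) [CommRing k] (a : NullRing k n r) :
    nullSwap k n r (nullSwap k n r a) = a := by
  have : (nullSwap k n r).comp (nullSwap k n r) = RingHom.id _ :=
    nullRing_hom_ext (fun a => by simp [nullSwap])
      fun i c => by simp [nullSwap, swapCoord_swapCoord]
  exact RingHom.congr_fun this a

/-! ### Splitting off a hyperbolic plane -/

/-- The inclusion of coordinates omitting the first hyperbolic plane. -/
def upCoord : Coord n r → Coord (n + 1) r :=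
  Sum.map Fin.succ (Sum.map Fin.succ id)

lemma splitForm_succ {B : Type*} [CommRing B] (v w : Coord (n + 1) r → B) :
    splitForm v w = v (Sum.inl 0) * w (Sum.inr (Sum.inl 0)) +
      v (Sum.inr (Sum.inl 0)) * w (Sum.inl 0) +
      splitForm (fun c => v (upCoord c)) (fun c => w (upCoord c)) := by
  simp only [splitForm, Fin.sum_univ_succ (n := n), upCoord, Sum.map_inl, Sum.map_inr, id]
  ring

lemma coord_succ_cases {P : Coord (n + 1) r → Prop} (hx : P (Sum.inl 0))
    (hy : P (Sum.inr (Sum.inl 0))) (hup : ∀ c : Coord n r, P (upCoord c)) (c) : P c := by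
  rcases c with a | a | l
  · exact Fin.cases hx (fun a => hup (Sum.inl a)) a
  · exact Fin.cases hy (fun a => hup (Sum.inr (Sum.inl a))) a
  · exact hup (Sum.inr (Sum.inr l))

/-- The vector with given components in the first hyperbolic plane and its complement. -/
def mkVec {B : Type*} (x y : B) (u : Coord n r → B) : Coord (n + 1) r → B
  | Sum.inl a => Fin.cases x (fun a => u (Sum.inl a)) a
  | Sum.inr (Sum.inl a) => Fin.cases y (fun a => u (Sum.inr (Sum.inl a))) a
  | Sum.inr (Sum.inr l) => u (Sum.inr (Sum.inr l))

section MkVec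

variable {B : Type*} (x y : B) (u : Coord n r → B)

@[simp] lemma mkVec_x : mkVec x y u (Sum.inl 0) = x := rfl

@[simp] lemma mkVec_y : mkVec x y u (Sum.inr (Sum.inl 0)) = y := rfl

@[simp] lemma mkVec_up (c : Coord n r) : mkVec x y u (upCoord c) = u c := by
  rcases c with a | a | l <;> rfl

end MkVec

/-- With `h = 1/2` and `x⁻¹` the inverse of the first coordinate of an isotropic vector with
components `u` in the complement of the first hyperbolic plane, the vector orthogonal to it with
first coordinate `t` and projection `s + t x⁻¹ u`. -/
def reconVec {B : Type*} [CommRing B] (h xi t : B) (u s : Coord n r → B) :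
    Coord (n + 1) r → B :=
  mkVec t (-xi * splitForm u s - t * h * xi ^ 2 * splitForm u u) (fun c => s c + t * xi * u c)

lemma splitForm_reconVec {B : Type*} [CommRing B] {h : B} (hh : 2 * h = 1) (xi t t' : B)
    (u s s' : Coord n r → B) :
    splitForm (reconVec h xi t u s) (reconVec h xi t' u s') = splitForm s s' := by
  simp only [reconVec, splitForm_succ, mkVec_x, mkVec_y, mkVec_up, splitForm_add_mul_left,
    splitForm_add_mul_right]
  rw [splitForm_comm s u]
  linear_combination (-t * t' * xi ^ 2 * splitForm u u) * hh

lemma map_reconVec {B B' : Type*} [CommRing B] [CommRing B'] (f : B →+* B') (h xi t : B)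
    (u s : Coord n r → B) (c : Coord (n + 1) r) :
    f (reconVec h xi t u s c) =
      reconVec (f h) (f xi) (f t) (fun c => f (u c)) (fun c => f (s c)) c := by
  induction c using coord_succ_cases with
  | hx => simp [reconVec]
  | hy => simp [reconVec, map_splitForm]
  | hup c => simp [reconVec]

lemma reconVec_eq {B : Type*} [CommRing B] {h xi : B} (hh : 2 * h = 1)
    {v w : Coord (n + 1) r → B} (hxi : v (Sum.inl 0) * xi = 1) (hv : splitForm v v = 0)
    (hvw : splitForm v w = 0) :
    reconVec h xi (w (Sum.inl 0)) (fun c => v (upCoord c))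
      (fun c => w (upCoord c) + -(w (Sum.inl 0) * xi) * v (upCoord c)) = w := by
  rw [splitForm_succ] at hv hvw
  funext c
  induction c using coord_succ_cases with
  | hx => simp [reconVec]
  | hy =>
    simp only [reconVec, mkVec_y, splitForm_add_mul_right]
    linear_combination (-xi) * hvw + (w (Sum.inl 0) * xi ^ 2 * h) * hv +
      (w (Sum.inr (Sum.inl 0)) - w (Sum.inl 0) * xi * v (Sum.inr (Sum.inl 0)) * (2 * h)) * hxi +
      (-(w (Sum.inl 0)) * xi ^ 2 * splitForm (fun c => v (upCoord c)) (fun c => v (upCoord c)) -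
        w (Sum.inl 0) * xi * v (Sum.inr (Sum.inl 0))) * hh
  | hup c => simp [reconVec]

/-! ### Normality criteria -/

lemma MvPolynomial.isIntegrallyClosed_of_finite (σ : Type*) [Finite σ] (k : Type*) [CommRing k]
    [IsDomain k] [IsIntegrallyClosed k] : IsIntegrallyClosed (MvPolynomial σ k) := by
  induction σ using Finite.induction_empty_option with
  | of_equiv e h => exact .of_equiv (renameEquiv k e).toRingEquiv
  | h_empty => exact .of_equiv (isEmptyRingEquiv k PEmpty).symm
  | h_option h => exact .of_equiv (optionEquivLeft k _).symm.toRingEquiv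

lemma isIntegrallyClosed_localizationAway {R : Type*} [CommRing R] [IsDomain R]
    [IsIntegrallyClosed R] {x : R} (hx : x ≠ 0) :
    IsDomain (Localization.Away x) ∧ IsIntegrallyClosed (Localization.Away x) := by
  have hle := powers_le_nonZeroDivisors_of_noZeroDivisors hx
  exact ⟨IsLocalization.isDomain_of_le_nonZeroDivisors _ hle,
    isIntegrallyClosed_of_isLocalization _ _ hle⟩

lemma IsIntegral.fractionRing_map {S L : Type*} [CommRing S] [IsDomain S] [CommRing L]
    [IsDomain L] {ψ : S →+* L} {f : FractionRing S} (hf : IsIntegral S f)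
    (hψ : Function.Injective ψ) :
    IsIntegral L (IsFractionRing.map hψ f : FractionRing L) := by
  let F : FractionRing S →+* FractionRing L := IsFractionRing.map hψ
  have hF : ∀ s, F (algebraMap S _ s) = algebraMap L _ (ψ s) :=
    fun s => IsLocalization.map_eq _ s
  obtain ⟨P, hP, hPf⟩ := hf
  refine ⟨P.map ψ, hP.map ψ, ?_⟩
  rw [Polynomial.eval₂_map, ← RingHom.map_zero F, ← hPf, Polynomial.hom_eval₂]
  congr 1
  ext s
  exact (hF s).symm

/-- If `S → L` behaves like the localization at `x` and `L` is a normal domain, then a fraction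
that is integral over `S` has a denominator that is a power of `x`. -/
lemma exists_pow_mul_eq_of_isIntegral {S L : Type*} [CommRing S] [IsDomain S] [CommRing L]
    [IsDomain L] [IsIntegrallyClosed L] (ψ : S →+* L) (hψ : Function.Injective ψ) (x : S)
    (hden : ∀ l, ∃ (m : ℕ) (s : S), ψ x ^ m * l = ψ s) {f : FractionRing S}
    (hf : IsIntegral S f) :
    ∃ (m : ℕ) (s : S), algebraMap S _ x ^ m * f = algebraMap S (FractionRing S) s := by
  let F : FractionRing S →+* FractionRing L := IsFractionRing.map hψ
  have hF : ∀ s, F (algebraMap S _ s) = algebraMap L _ (ψ s) :=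
    fun s => IsLocalization.map_eq _ s
  have hint : IsIntegral L (F f) := hf.fractionRing_map hψ
  obtain ⟨l, hl⟩ := IsIntegrallyClosed.isIntegral_iff.mp hint
  obtain ⟨m, s, hs⟩ := hden l
  refine ⟨m, s, F.injective ?_⟩
  rw [map_mul, map_pow, hF, hF, ← hl, ← map_pow, ← map_mul, hs]

/-- A domain with a regular sequence `x, y` away from which it is normal, is normal. -/
lemma isIntegrallyClosed_of_regular_pair {S L L' : Type*} [CommRing S] [IsDomain S]
    [CommRing L] [IsDomain L] [IsIntegrallyClosed L]
    [CommRing L'] [IsDomain L'] [IsIntegrallyClosed L'] (x y : S) (hx : x ≠ 0)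
    (hxy : ∀ u v, y * u = x * v → x ∣ u)
    (ψ : S →+* L) (hψ : Function.Injective ψ) (hden : ∀ l, ∃ (m : ℕ) (s : S), ψ x ^ m * l = ψ s)
    (ψ' : S →+* L') (hψ' : Function.Injective ψ')
    (hden' : ∀ l, ∃ (m : ℕ) (s : S), ψ' y ^ m * l = ψ' s) : IsIntegrallyClosed S := by
  rw [isIntegrallyClosed_iff (FractionRing S)]
  intro f hf
  obtain ⟨m, s, hs⟩ := exists_pow_mul_eq_of_isIntegral ψ hψ x hden hf
  obtain ⟨m', t, ht⟩ := exists_pow_mul_eq_of_isIntegral ψ' hψ' y hden' hf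
  have hxyp : ∀ (a : ℕ) (u v : S), y ^ a * u = x * v → x ∣ u := by
    intro a
    induction a with
    | zero => intro u v h; exact ⟨v, by simpa using h⟩
    | succ a ih =>
      intro u v h
      obtain ⟨w, hw⟩ := hxy (y ^ a * u) v (by rw [← h]; ring)
      exact ih u w hw
  have key : ∀ (b : ℕ) (u v : S), y ^ m' * u = x ^ b * v → x ^ b ∣ u := by
    intro b
    induction b with
    | zero => intro u v _; simp
    | succ b ih =>
      intro u v h
      obtain ⟨w, rfl⟩ := hxyp m' u (x ^ b * v) (by rw [h]; ring)
      obtain ⟨z, rfl⟩ := ih w v (mul_left_cancel₀ hx (by linear_combination h))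
      exact ⟨z, by ring⟩
  obtain ⟨g, rfl⟩ := key m s t (by
    apply IsFractionRing.injective S (FractionRing S)
    rw [map_mul, map_mul, map_pow, map_pow, ← hs, ← ht]
    ring)
  refine ⟨g, ?_⟩
  have hx0 : algebraMap S (FractionRing S) x ^ m ≠ 0 :=
    pow_ne_zero _ (by simpa using hx)
  apply mul_left_cancel₀ hx0
  rw [hs, map_mul, map_pow]

/-! ### Normality of the null cone -/

section Chart

variable (k : Type*) [CommRing k] (n r : ℕ)

/-- The coordinate ring of the closure of the chart of the null cone on which the first isotropic
coordinate of the first vector is invertible. -/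
abbrev ChartPoly : Type _ := MvPolynomial (Fin (n + 1) ⊕ Coord n r) (NullRing k n r)

/-- The chart of the null cone on which the first isotropic coordinate of the first vector is
invertible. -/
abbrev Chart : Type _ := Localization.Away (X (Sum.inl 0) : ChartPoly k n r)

/-- The inverse of the distinguished coordinate of the chart. -/
noncomputable def chartInv : Chart k n r :=
  IsLocalization.Away.invSelf (X (Sum.inl 0) : ChartPoly k n r)

/-- The free coordinates of the chart. -/
noncomputable def chartCoord (v : Fin (n + 1) ⊕ Coord n r) : Chart k n r :=
  algebraMap (ChartPoly k n r) _ (X v)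

/-- The vectors of the smaller null cone, in the chart, preceded by a zero vector. -/
noncomputable def chartSmall (i : Fin (n + 1)) (c : Coord n r) : Chart k n r :=
  Fin.cases 0 (fun j => algebraMap (ChartPoly k n r) _ (C (nullVec k n r j c))) i

variable {n r} {k}

lemma chartCoord_mul_chartInv : chartCoord k n r (Sum.inl 0) * chartInv k n r = 1 :=
  IsLocalization.Away.mul_invSelf (X (Sum.inl 0) : ChartPoly k n r)

lemma splitForm_chartSmall (i j : Fin (n + 1)) :
    splitForm (chartSmall k n r i) (chartSmall k n r j) = 0 := by
  cases i using Fin.cases with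
  | zero => simp [splitForm, chartSmall]
  | succ i =>
    cases j using Fin.cases with
    | zero => simp [splitForm, chartSmall]
    | succ j =>
      have := map_splitForm ((algebraMap (ChartPoly k n r) (Chart k n r)).comp C)
        (nullVec k n r i) (nullVec k n r j)
      rw [splitForm_nullVec, map_zero] at this
      exact this.symm

/-- The inclusion of the chart into the null cone, on coordinate rings. -/
noncomputable def toChart {h : k} (hh : 2 * h = 1) : NullRing k (n + 1) r →+* Chart k n r :=
  nullLift (algebraMap k _)
    (fun i => reconVec (algebraMap k _ h) (chartInv k n r) (chartCoord k n r (Sum.inl i))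
      (fun c => chartCoord k n r (Sum.inr c)) (chartSmall k n r i))
    fun i j => by
      rw [splitForm_reconVec, splitForm_chartSmall]
      rw [← map_ofNat (algebraMap k (Chart k n r)) 2, ← map_mul, hh, map_one]

lemma toChart_x {h : k} (hh : 2 * h = 1) (i : Fin (n + 1)) :
    toChart hh (nullVec k (n + 1) r i (Sum.inl 0)) = chartCoord k n r (Sum.inl i) := by
  simp [toChart, reconVec]

lemma toChart_up {h : k} (hh : 2 * h = 1) (i : Fin (n + 1)) (c : Coord n r) :
    toChart hh (nullVec k (n + 1) r i (upCoord c)) = chartSmall k n r i c +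
      chartCoord k n r (Sum.inl i) * chartInv k n r * chartCoord k n r (Sum.inr c) := by
  simp [toChart, reconVec]

lemma toChart_up_zero {h : k} (hh : 2 * h = 1) (c : Coord n r) :
    toChart hh (nullVec k (n + 1) r 0 (upCoord c)) = chartCoord k n r (Sum.inr c) := by
  rw [toChart_up, chartCoord_mul_chartInv]
  simp [chartSmall]

lemma toChart_denominators {h : k} (hh : 2 * h = 1) (l : Chart k n r) :
    ∃ (m : ℕ) (s : NullRing k (n + 1) r),
      toChart hh (nullVec k (n + 1) r 0 (Sum.inl 0)) ^ m * l = toChart hh s := by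
  set x := nullVec k (n + 1) r 0 (Sum.inl 0) with hx
  let P : Chart k n r → Prop := fun l => ∃ (m : ℕ) (s : NullRing k (n + 1) r),
    toChart hh x ^ m * l = toChart hh s
  have hrange : ∀ s, P (toChart hh s) := fun s => ⟨0, s, by simp⟩
  have hadd : ∀ a b, P a → P b → P (a + b) := by
    rintro a b ⟨m, s, hs⟩ ⟨m', s', hs'⟩
    refine ⟨m + m', x ^ m' * s + x ^ m * s', ?_⟩
    rw [map_add, map_mul, map_mul, ← hs, ← hs', map_pow, map_pow]
    ring
  have hmul : ∀ a b, P a → P b → P (a * b) := by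
    rintro a b ⟨m, s, hs⟩ ⟨m', s', hs'⟩
    refine ⟨m + m', s * s', ?_⟩
    rw [map_mul, ← hs, ← hs']
    ring
  have hpoly : ∀ t : ChartPoly k n r, P (algebraMap _ _ t) := by
    intro t
    induction t using MvPolynomial.induction_on with
    | C a =>
      induction a using nullRing_induction with
      | hC a =>
        have : algebraMap (ChartPoly k n r) (Chart k n r) (C (algebraMap k _ a)) =
            toChart hh (algebraMap k _ a) := by
          rw [toChart, nullLift_algebraMap]; rfl
        rw [this]
        exact hrange _
      | hadd a b ha hb => rw [map_add, map_add]; exact hadd _ _ ha hb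
      | hmul a b ha hb => rw [map_mul, map_mul]; exact hmul _ _ ha hb
      | hvec i c =>
        refine ⟨1, x * nullVec k (n + 1) r i.succ (upCoord c) -
          nullVec k (n + 1) r i.succ (Sum.inl 0) * nullVec k (n + 1) r 0 (upCoord c), ?_⟩
        rw [map_sub, map_mul, map_mul, toChart_up, toChart_up_zero, toChart_x, toChart_x]
        simp only [chartSmall, Fin.cases_succ]
        linear_combination (-(chartCoord k n r (Sum.inl i.succ)) * chartCoord k n r (Sum.inr c)) *
          chartCoord_mul_chartInv (k := k) (n := n) (r := r)
    | add p q hp hq => rw [map_add]; exact hadd _ _ hp hq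
    | mul_X p v hp =>
      rw [map_mul]
      refine hmul _ _ hp ?_
      rcases v with i | c
      · have := hrange (nullVec k (n + 1) r i (Sum.inl 0))
        rwa [toChart_x] at this
      · have := hrange (nullVec k (n + 1) r 0 (upCoord c))
        rwa [toChart_up_zero] at this
  obtain ⟨m, t, ht⟩ := IsLocalization.Away.surj (X (Sum.inl 0) : ChartPoly k n r) l
  obtain ⟨m', s, hs⟩ := hpoly t
  refine ⟨m' + m, s, ?_⟩
  rw [← hs, ← ht, hx, toChart_x, chartCoord]
  ring

lemma toChart_injective {h : k} (hh : 2 * h = 1) :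
    Function.Injective (toChart (n := n) (r := r) hh) := by
  set x := nullVec k (n + 1) r 0 (Sum.inl 0) with hx
  let S' := Localization.Away x
  let α : NullRing k (n + 1) r →+* S' := algebraMap _ _
  let V : Fin (n + 1) → Coord (n + 1) r → S' := fun i c => α (nullVec k (n + 1) r i c)
  let xi : S' := IsLocalization.Away.invSelf x
  have hxi : V 0 (Sum.inl 0) * xi = 1 := IsLocalization.Away.mul_invSelf x
  have hV : ∀ i j, splitForm (V i) (V j) = 0 := fun i j => by
    have := map_splitForm α (nullVec k (n + 1) r i) (nullVec k (n + 1) r j)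
    rw [splitForm_nullVec, map_zero] at this
    exact this.symm
  let h' : S' := algebraMap k S' h
  have hh' : 2 * h' = 1 := by
    rw [← map_ofNat (algebraMap k S') 2, ← map_mul, hh, map_one]
  let s : Fin (n + 1) → Coord n r → S' := fun i c =>
    V i (upCoord c) + -(V i (Sum.inl 0) * xi) * V 0 (upCoord c)
  have hrec : ∀ i, reconVec h' xi (V i (Sum.inl 0)) (fun c => V 0 (upCoord c)) (s i) = V i :=
    fun i => reconVec_eq hh' hxi (hV 0 0) (hV 0 i)
  have hs : ∀ i j, splitForm (s i) (s j) = 0 := fun i j => by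
    rw [← splitForm_reconVec hh' xi (V i (Sum.inl 0)) (V j (Sum.inl 0))
      (fun c => V 0 (upCoord c)), hrec, hrec, hV]
  let φ : ChartPoly k n r →+* S' :=
    eval₂Hom (nullLift (algebraMap k S') (fun i => s i.succ) fun i j => hs _ _)
      (Sum.elim (fun i => V i (Sum.inl 0)) (fun c => V 0 (upCoord c)))
  have hφx : φ (X (Sum.inl 0)) = V 0 (Sum.inl 0) := by simp [φ]
  let Φ : Chart k n r →+* S' := IsLocalization.Away.lift (X (Sum.inl 0))
    (show IsUnit (φ (X (Sum.inl 0))) from hφx ▸ IsUnit.of_mul_eq_one _ hxi)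
  have hΦ : ∀ t, Φ (algebraMap _ _ t) = φ t := fun t => IsLocalization.Away.lift_eq _ _ t
  have hΦc : ∀ v, Φ (chartCoord k n r v) = φ (X v) := fun v => hΦ _
  have hΦxi : Φ (chartInv k n r) = xi := by
    have h1 := congrArg Φ (chartCoord_mul_chartInv (k := k) (n := n) (r := r))
    rw [map_mul, map_one, hΦc, hφx] at h1
    linear_combination xi * h1 - Φ (chartInv k n r) * hxi
  have hΦs : ∀ i c, Φ (chartSmall k n r i c) = s i c := by
    intro i c
    cases i using Fin.cases with
    | zero =>
      simp only [chartSmall, Fin.cases_zero, map_zero, s]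
      rw [hxi]
      ring
    | succ i =>
      simp only [chartSmall, Fin.cases_succ]
      rw [hΦ]
      simp [φ]
  have hΦk : ∀ a : k, Φ (algebraMap k _ a) = algebraMap k S' a := by
    intro a
    have : algebraMap k (Chart k n r) a =
      algebraMap (ChartPoly k n r) _ (C (algebraMap k _ a)) := rfl
    rw [this, hΦ]
    simp [φ]
  have hcomp : Φ.comp (toChart hh) = α := by
    refine nullRing_hom_ext (fun a => ?_) fun i c => ?_
    · simp only [RingHom.comp_apply, toChart, nullLift_algebraMap]
      rw [hΦk]
      rfl
    · simp only [RingHom.comp_apply, toChart, nullLift_nullVec]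
      rw [map_reconVec, hΦxi, hΦc, hΦk]
      have h1 : (fun c => Φ (chartCoord k n r (Sum.inr c))) = fun c => V 0 (upCoord c) := by
        funext c; rw [hΦc]; simp [φ]
      have h2 : (fun c => Φ (chartSmall k n r i c)) = s i := funext (hΦs i)
      have h3 : φ (X (Sum.inl i)) = V i (Sum.inl 0) := by simp [φ]
      rw [h1, h2, h3]
      exact congrFun (hrec i) c
  have hα : Function.Injective α := by
    refine IsLocalization.injective S' (M := Submonoid.powers x) ?_
    refine Submonoid.powers_le.mpr (mem_nonZeroDivisors_iff_right.mpr fun u hu => ?_)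
    exact nullVec_x_mul_eq_zero k u (by rw [mul_comm]; exact hu)
  refine Function.Injective.of_comp (f := Φ) ?_
  rw [← RingHom.coe_comp, hcomp]
  exact hα

/-- The null cone of `n` vectors in a quadratic space of dimension at least `2n + 1` over a normal
base is normal. -/
theorem nullRing_normal (k : Type*) [CommRing k] [IsDomain k] [IsIntegrallyClosed k] {h : k}
    (hh : 2 * h = 1) (n r : ℕ) :
    IsDomain (NullRing k n r) ∧ IsIntegrallyClosed (NullRing k n r) := by
  induction n with
  | zero =>
    have hbot : Ideal.span (Set.range (nullEqn k 0 r)) = ⊥ := by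
      rw [Ideal.span_eq_bot]
      rintro _ ⟨e, -⟩
      exact e.1.1.elim0
    let e : NullRing k 0 r ≃+* k := (Ideal.quotEquivOfEq hbot).trans
      ((RingEquiv.quotientBot _).trans (isEmptyRingEquiv k _))
    exact ⟨e.toMulEquiv.isDomain k, .of_equiv e.symm⟩
  | succ n ih =>
    obtain ⟨_, _⟩ := ih
    have : IsIntegrallyClosed (ChartPoly k n r) := isIntegrallyClosed_of_finite _ _
    obtain ⟨_, _⟩ : IsDomain (Chart k n r) ∧ IsIntegrallyClosed (Chart k n r) :=
      isIntegrallyClosed_localizationAway (X_ne_zero _)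
    have hinj := toChart_injective (n := n) (r := r) hh
    have : IsDomain (NullRing k (n + 1) r) := hinj.isDomain (toChart hh)
    refine ⟨this, isIntegrallyClosed_of_regular_pair _ _ ?_ (nullVec_x_dvd_of_y_mul_eq k)
      (toChart hh) hinj (toChart_denominators hh)
      ((toChart hh).comp (nullSwap k (n + 1) r)) (hinj.comp ?_) ?_⟩
    · intro h0
      exact one_ne_zero (nullVec_x_mul_eq_zero k (n := n) (r := r) 1 (by rw [h0, zero_mul]))
    · exact Function.LeftInverse.injective (nullSwap_nullSwap k)
    · intro l
      obtain ⟨m, s, hs⟩ := toChart_denominators hh l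
      refine ⟨m, nullSwap k _ _ s, ?_⟩
      have hy : nullSwap k (n + 1) r (nullVec k (n + 1) r 0 (Sum.inr (Sum.inl 0))) =
          nullVec k (n + 1) r 0 (Sum.inl 0) := by
        simp [nullSwap, swapCoord]
      simp only [RingHom.comp_apply, nullSwap_nullSwap, hy, hs]

end Chart

/-! ### Orthonormal coordinates -/

/-- The hyperbolic coordinates of a vector given by orthonormal coordinates, for `I ^ 2 = -1` and
`h = 1/2`. -/
def toHyp {B : Type*} [CommRing B] (I h : B) (v : Coord n r → B) : Coord n r → B
  | Sum.inl a => v (Sum.inl a) + I * v (Sum.inr (Sum.inl a))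
  | Sum.inr (Sum.inl a) => h * (v (Sum.inl a) - I * v (Sum.inr (Sum.inl a)))
  | Sum.inr (Sum.inr l) => v (Sum.inr (Sum.inr l))

/-- The inverse of `toHyp`. -/
def fromHyp {B : Type*} [CommRing B] (I h : B) (v : Coord n r → B) : Coord n r → B
  | Sum.inl a => h * v (Sum.inl a) + v (Sum.inr (Sum.inl a))
  | Sum.inr (Sum.inl a) => -I * (h * v (Sum.inl a) - v (Sum.inr (Sum.inl a)))
  | Sum.inr (Sum.inr l) => v (Sum.inr (Sum.inr l))

section Hyp

variable {B B' : Type*} [CommRing B] [CommRing B'] {I h : B}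

lemma splitForm_toHyp (hI : I * I = -1) (hh : 2 * h = 1) (v w : Coord n r → B) :
    splitForm (toHyp I h v) (toHyp I h w) = ∑ c, v c * w c := by
  simp only [splitForm, toHyp, Fintype.sum_sum_type]
  rw [← add_assoc, ← Finset.sum_add_distrib]
  congr 1
  refine Finset.sum_congr rfl fun a _ => ?_
  linear_combination (v (Sum.inl a) * w (Sum.inl a) -
    I * I * v (Sum.inr (Sum.inl a)) * w (Sum.inr (Sum.inl a))) * hh -
    v (Sum.inr (Sum.inl a)) * w (Sum.inr (Sum.inl a)) * hI

lemma toHyp_fromHyp (hI : I * I = -1) (hh : 2 * h = 1) (v : Coord n r → B) :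
    toHyp I h (fromHyp I h v) = v := by
  funext c
  rcases c with a | a | l
  · simp only [toHyp, fromHyp]
    linear_combination (-(h * v (Sum.inl a) - v (Sum.inr (Sum.inl a)))) * hI + v (Sum.inl a) * hh
  · simp only [toHyp, fromHyp]
    linear_combination h * (h * v (Sum.inl a) - v (Sum.inr (Sum.inl a))) * hI +
      v (Sum.inr (Sum.inl a)) * hh
  · rfl

lemma fromHyp_toHyp (hI : I * I = -1) (hh : 2 * h = 1) (v : Coord n r → B) :
    fromHyp I h (toHyp I h v) = v := by
  funext c
  rcases c with a | a | l
  · simp only [toHyp, fromHyp]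
    linear_combination v (Sum.inl a) * hh
  · simp only [toHyp, fromHyp]
    linear_combination (-(I * I) * v (Sum.inr (Sum.inl a))) * hh -
      v (Sum.inr (Sum.inl a)) * hI
  · rfl

lemma sum_fromHyp (hI : I * I = -1) (hh : 2 * h = 1) (v w : Coord n r → B) :
    ∑ c, fromHyp I h v c * fromHyp I h w c = splitForm v w := by
  rw [← splitForm_toHyp hI hh, toHyp_fromHyp hI hh, toHyp_fromHyp hI hh]

lemma map_toHyp (f : B →+* B') (v : Coord n r → B) (c : Coord n r) :
    f (toHyp I h v c) = toHyp (f I) (f h) (fun c => f (v c)) c := by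
  rcases c with a | a | l <;> simp [toHyp]

lemma map_fromHyp (f : B →+* B') (v : Coord n r → B) (c : Coord n r) :
    f (fromHyp I h v c) = fromHyp (f I) (f h) (fun c => f (v c)) c := by
  rcases c with a | a | l <;> simp [fromHyp]

end Hyp

end NullRing

/-! ### The null cone of a pair of matrices -/

section NullCone

variable {p q n : ℕ}

lemma sum_inl_mem_nullConeIdealOSp (i j : Fin n) :
    ∑ k : Fin p, X (Sum.inl (k, i)) * X (Sum.inl (k, j)) ∈ nullConeIdealOSp p q n := by
  rcases le_total i j with h | h
  · exact Ideal.subset_span (Or.inl ⟨i, j, h, rfl⟩)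
  · exact Ideal.subset_span (Or.inl ⟨j, i, h, Finset.sum_congr rfl fun _ _ => mul_comm _ _⟩)

lemma sum_inr_mem_nullConeIdealOSp (i j : Fin n) :
    ∑ l : Fin q, X (Sum.inr (l, i)) * X (Sum.inr (l, j)) ∈ nullConeIdealOSp p q n := by
  rcases le_total i j with h | h
  · exact Ideal.subset_span (Or.inr ⟨i, j, h, rfl⟩)
  · exact Ideal.subset_span (Or.inr ⟨j, i, h, Finset.sum_congr rfl fun _ _ => mul_comm _ _⟩)

lemma sum_linearCombination_mem {R κ ι : Type*} [CommRing R] [Fintype κ] [Fintype ι]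
    {J : Ideal R} (x : κ → ι → R) (hx : ∀ i j, ∑ k, x k i * x k j ∈ J) (c d : ι → R) :
    ∑ k, (∑ i, c i * x k i) * (∑ j, d j * x k j) ∈ J := by
  have : ∑ k, (∑ i, c i * x k i) * (∑ j, d j * x k j) =
      ∑ i, ∑ j, c i * d j * ∑ k, x k i * x k j := by
    simp only [Fintype.sum_mul_sum]
    simp only [Finset.mul_sum]
    rw [Finset.sum_comm]
    refine Finset.sum_congr rfl fun i _ => ?_
    rw [Finset.sum_comm]
    exact Finset.sum_congr rfl fun j _ => Finset.sum_congr rfl fun k _ => by ring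
  rw [this]
  exact J.sum_mem fun i _ => J.sum_mem fun j _ => J.mul_mem_left _ (hx i j)

lemma glSubstAction_mem (g : GL (Fin n) ℂ)
    (r : MvPolynomial ((Fin p × Fin n) ⊕ (Fin q × Fin n)) ℂ) (hr : r ∈ nullConeIdealOSp p q n) :
    glSubstAction p q n g r ∈ nullConeIdealOSp p q n := by
  have hle : nullConeIdealOSp p q n ≤
      (nullConeIdealOSp p q n).comap (glSubstAction p q n g) := by
    rw [nullConeIdealOSp, Ideal.span_le, ← nullConeIdealOSp]
    rintro _ (⟨i, j, -, rfl⟩ | ⟨i, j, -, rfl⟩)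
    · simp only [SetLike.mem_coe, Ideal.mem_comap, glSubstAction, map_sum, map_mul, aeval_X]
      exact sum_linearCombination_mem _ sum_inl_mem_nullConeIdealOSp _ _
    · simp only [SetLike.mem_coe, Ideal.mem_comap, glSubstAction, map_sum, map_mul, aeval_X]
      exact sum_linearCombination_mem _ sum_inr_mem_nullConeIdealOSp _ _
  exact hle hr

variable (p q n) in
/-- The coordinate ring of the null cone. -/
abbrev NullConeRing : Type :=
  MvPolynomial ((Fin p × Fin n) ⊕ (Fin q × Fin n)) ℂ ⧸ nullConeIdealOSp p q n

/-- The universal property of the coordinate ring of the null cone. -/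
noncomputable def nullConeLift {B : Type*} [CommRing B] (f : ℂ →+* B) (V : Fin p → Fin n → B)
    (W : Fin q → Fin n → B) (hV : ∀ i j, ∑ k, V k i * V k j = 0)
    (hW : ∀ i j, ∑ k, W k i * W k j = 0) : NullConeRing p q n →+* B :=
  Ideal.Quotient.lift _
    (eval₂Hom f (Sum.elim (fun v => V v.1 v.2) fun v => W v.1 v.2)) fun a ha => by
    have hle : nullConeIdealOSp p q n ≤
        RingHom.ker (eval₂Hom f (Sum.elim (fun v => V v.1 v.2) fun v => W v.1 v.2)) := by
      rw [nullConeIdealOSp, Ideal.span_le]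
      rintro _ (⟨i, j, -, rfl⟩ | ⟨i, j, -, rfl⟩)
      · simpa [RingHom.mem_ker] using hV i j
      · simpa [RingHom.mem_ker] using hW i j
    exact hle ha

variable (p q n) in
/-- The coordinates on the null cone. -/
noncomputable def nullConeCoord (v : (Fin p × Fin n) ⊕ (Fin q × Fin n)) : NullConeRing p q n :=
  Ideal.Quotient.mk _ (X v)

lemma sum_nullConeCoord_inl (i j : Fin n) :
    ∑ k, nullConeCoord p q n (Sum.inl (k, i)) * nullConeCoord p q n (Sum.inl (k, j)) = 0 := by
  simp only [nullConeCoord, ← map_mul, ← map_sum]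
  exact Ideal.Quotient.eq_zero_iff_mem.mpr (sum_inl_mem_nullConeIdealOSp i j)

lemma sum_nullConeCoord_inr (i j : Fin n) :
    ∑ k, nullConeCoord p q n (Sum.inr (k, i)) * nullConeCoord p q n (Sum.inr (k, j)) = 0 := by
  simp only [nullConeCoord, ← map_mul, ← map_sum]
  exact Ideal.Quotient.eq_zero_iff_mem.mpr (sum_inr_mem_nullConeIdealOSp i j)

section Lift

variable {B : Type*} [CommRing B] (f : ℂ →+* B) (V : Fin p → Fin n → B)
    (W : Fin q → Fin n → B) (hV : ∀ i j, ∑ k, V k i * V k j = 0)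
    (hW : ∀ i j, ∑ k, W k i * W k j = 0)

@[simp]
lemma nullConeLift_inl (k : Fin p) (i : Fin n) :
    nullConeLift f V W hV hW (nullConeCoord p q n (Sum.inl (k, i))) = V k i :=
  (Ideal.Quotient.lift_mk _ _ _).trans (by simp)

@[simp]
lemma nullConeLift_inr (k : Fin q) (i : Fin n) :
    nullConeLift f V W hV hW (nullConeCoord p q n (Sum.inr (k, i))) = W k i :=
  (Ideal.Quotient.lift_mk _ _ _).trans (by simp)

@[simp]
lemma nullConeLift_algebraMap (a : ℂ) :
    nullConeLift f V W hV hW (algebraMap ℂ (NullConeRing p q n) a) = f a := by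
  change nullConeLift f V W hV hW (Ideal.Quotient.mk _ (C a)) = f a
  exact (Ideal.Quotient.lift_mk _ _ _).trans (by simp)

end Lift

lemma nullCone_hom_ext {B : Type*} [CommRing B] {g g' : NullConeRing p q n →+* B}
    (hC : ∀ a, g (algebraMap ℂ _ a) = g' (algebraMap ℂ _ a))
    (hv : ∀ v, g (nullConeCoord p q n v) = g' (nullConeCoord p q n v)) : g = g' := by
  ext1
  exact MvPolynomial.ringHom_ext (fun a => hC a) hv

/-- The null cone of a pair of matrices is a product of two null cones. -/
noncomputable def nullConeEquiv {r s : ℕ} (e : Fin p ≃ Coord n r) (e' : Fin q ≃ Coord n s) :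
    NullConeRing p q n ≃+* NullRing (NullRing ℂ n r) n s := by
  have hI : ∀ (B : Type) [CommRing B] [Algebra ℂ B],
      algebraMap ℂ B Complex.I * algebraMap ℂ B Complex.I = -1 := fun B _ _ => by
    rw [← map_mul, Complex.I_mul_I, map_neg, map_one]
  have hh : ∀ (B : Type) [CommRing B] [Algebra ℂ B], 2 * algebraMap ℂ B 2⁻¹ = 1 := fun B _ _ => by
    rw [← map_ofNat (algebraMap ℂ B) 2, ← map_mul, mul_inv_cancel₀ two_ne_zero, map_one]
  refine RingEquiv.ofRingHom
    (nullConeLift (algebraMap ℂ _)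
      (fun k i => algebraMap (NullRing ℂ n r) _
        (fromHyp (algebraMap ℂ _ Complex.I) (algebraMap ℂ _ 2⁻¹) (nullVec ℂ n r i) (e k)))
      (fun l i => fromHyp (algebraMap ℂ _ Complex.I) (algebraMap ℂ _ 2⁻¹)
        (nullVec (NullRing ℂ n r) n s i) (e' l)) ?_ ?_)
    (nullLift
      (nullLift (algebraMap ℂ _)
        (fun i => toHyp (algebraMap ℂ _ Complex.I) (algebraMap ℂ _ 2⁻¹)
          fun c => nullConeCoord p q n (Sum.inl (e.symm c, i))) ?_)
      (fun i => toHyp (algebraMap ℂ _ Complex.I) (algebraMap ℂ _ 2⁻¹)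
          fun c => nullConeCoord p q n (Sum.inr (e'.symm c, i))) ?_) ?_ ?_
  · intro i j
    simp only [← map_mul, ← map_sum]
    rw [e.sum_comp fun c => fromHyp (algebraMap ℂ _ Complex.I) (algebraMap ℂ _ 2⁻¹)
      (nullVec ℂ n r i) c * fromHyp (algebraMap ℂ _ Complex.I) (algebraMap ℂ _ 2⁻¹)
      (nullVec ℂ n r j) c, sum_fromHyp (hI _) (hh _), splitForm_nullVec, map_zero]
  · intro i j
    rw [e'.sum_comp fun c => fromHyp (algebraMap ℂ _ Complex.I) (algebraMap ℂ _ 2⁻¹)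
      (nullVec (NullRing ℂ n r) n s i) c * fromHyp (algebraMap ℂ _ Complex.I) (algebraMap ℂ _ 2⁻¹)
      (nullVec (NullRing ℂ n r) n s j) c, sum_fromHyp (hI _) (hh _), splitForm_nullVec]
  · intro i j
    rw [splitForm_toHyp (hI _) (hh _), e.symm.sum_comp fun k =>
      nullConeCoord p q n (Sum.inl (k, i)) * nullConeCoord p q n (Sum.inl (k, j)),
      sum_nullConeCoord_inl]
  · intro i j
    rw [splitForm_toHyp (hI _) (hh _), e'.symm.sum_comp fun k =>
      nullConeCoord p q n (Sum.inr (k, i)) * nullConeCoord p q n (Sum.inr (k, j)),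
      sum_nullConeCoord_inr]
  · have hC : ∀ a : ℂ, algebraMap (NullRing ℂ n r) (NullRing (NullRing ℂ n r) n s)
        (algebraMap ℂ _ a) = algebraMap ℂ _ a := fun a => rfl
    refine nullRing_hom_ext (fun a => ?_) fun i c => ?_
    · induction a using nullRing_induction with
      | hC a =>
        simp only [RingHom.comp_apply, nullLift_algebraMap, nullConeLift_algebraMap,
          RingHom.id_apply]
        rfl
      | hadd a b ha hb => rw [map_add, map_add, map_add, ha, hb]
      | hmul a b ha hb => rw [map_mul, map_mul, map_mul, ha, hb]
      | hvec i c =>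
        simp only [RingHom.comp_apply, nullLift_algebraMap, nullLift_nullVec, map_toHyp,
          nullConeLift_algebraMap, nullConeLift_inl, Equiv.apply_symm_apply, RingHom.id_apply]
        rw [← hC, ← hC, ← map_toHyp, toHyp_fromHyp (hI _) (hh _)]
    · simp only [RingHom.comp_apply, nullLift_nullVec, map_toHyp,
        nullConeLift_algebraMap, nullConeLift_inr, Equiv.apply_symm_apply, RingHom.id_apply]
      rw [toHyp_fromHyp (hI _) (hh _)]
  · refine nullCone_hom_ext (fun a => ?_) ?_
    · simp only [RingHom.comp_apply, nullConeLift_algebraMap, RingHom.id_apply]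
      exact (nullLift_algebraMap _ _ _ _).trans (nullLift_algebraMap _ _ _ _)
    · rintro (⟨k, i⟩ | ⟨k, i⟩)
      · simp only [RingHom.comp_apply, nullConeLift_inl, nullLift_algebraMap, map_fromHyp,
          nullLift_nullVec, RingHom.id_apply]
        rw [fromHyp_toHyp (hI _) (hh _), Equiv.symm_apply_apply]
      · simp only [RingHom.comp_apply, nullConeLift_inr, map_fromHyp, nullLift_nullVec,
          RingHom.id_apply]
        have hC : ∀ a : ℂ, algebraMap ℂ (NullRing (NullRing ℂ n r) n s) a =
          algebraMap (NullRing ℂ n r) _ (algebraMap ℂ _ a) := fun a => rfl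
        rw [hC, hC, nullLift_algebraMap, nullLift_algebraMap, nullLift_algebraMap,
          nullLift_algebraMap, fromHyp_toHyp (hI _) (hh _), Equiv.symm_apply_apply]

/-- The null cone is normal in the stable range. -/
theorem nullConeRing_normal (h1 : 2 * n < p) (h2 : 2 * n < q) :
    IsDomain (NullConeRing p q n) ∧ IsIntegrallyClosed (NullConeRing p q n) := by
  obtain ⟨r, rfl⟩ := Nat.exists_eq_add_of_lt h1
  obtain ⟨s, rfl⟩ := Nat.exists_eq_add_of_lt h2
  have he : ∀ r, Nonempty (Fin (2 * n + r + 1) ≃ Coord n r) := fun r =>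
    ⟨Fintype.equivOfCardEq (by simp; ring)⟩
  have hh : (2 : ℂ) * 2⁻¹ = 1 := mul_inv_cancel₀ two_ne_zero
  obtain ⟨_, _⟩ := nullRing_normal ℂ hh n r
  obtain ⟨_, _⟩ := nullRing_normal (NullRing ℂ n r) (h := algebraMap ℂ _ 2⁻¹)
    (by rw [← map_ofNat (algebraMap ℂ _) 2, ← map_mul, hh, map_one]) n s
  let e := nullConeEquiv (he r).some (he s).some
  exact ⟨e.toMulEquiv.isDomain _, .of_equiv e.symm⟩

end NullCone

/-- The invariants of a normal domain form a normal domain. -/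
theorem fixedSubalgebra_normal {Q : Type*} [CommRing Q] [Algebra ℂ Q] [IsDomain Q]
    [IsIntegrallyClosed Q] (n : ℕ) (bar : GL (Fin n) ℂ → (Q →ₐ[ℂ] Q)) :
    IsDomain (fixedSubalgebra n bar) ∧ IsIntegrallyClosed (fixedSubalgebra n bar) := by
  refine ⟨inferInstance, ?_⟩
  set F := fixedSubalgebra n bar
  have hinj : Function.Injective (algebraMap F Q) := Subtype.val_injective
  rw [isIntegrallyClosed_iff (FractionRing F)]
  intro f hf
  let φ : FractionRing F →+* FractionRing Q := IsFractionRing.map hinj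
  have hφ : ∀ a : F, φ (algebraMap F _ a) = algebraMap Q _ (a : Q) :=
    fun a => IsLocalization.map_eq _ a
  have hint : IsIntegral Q (φ f) := hf.fractionRing_map hinj
  obtain ⟨c, hc⟩ := IsIntegrallyClosed.isIntegral_iff.mp hint
  obtain ⟨a, b, hb, hab⟩ := IsFractionRing.div_surjective (A := F) f
  have hb0 : b ≠ 0 := nonZeroDivisors.ne_zero hb
  have hbc : (b : Q) * c = a := by
    apply IsFractionRing.injective Q (FractionRing Q)
    rw [map_mul, hc, ← hφ, ← hφ, ← map_mul, ← hab,
      mul_div_cancel₀ _ (by simpa using hb0)]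
  have hcF : ∀ g, bar g c = c := fun g => by
    have h := congrArg (bar g) hbc
    rw [map_mul, b.2 g, a.2 g, ← hbc] at h
    exact mul_left_cancel₀ (by simpa using hb0) h
  refine ⟨⟨c, hcF⟩, φ.injective ?_⟩
  rw [hφ, ← hc]

/-- For the dual pair `(O(p,q), Sp(2n,ℝ))` in the stable range `2n < min(p,q)`:
the substitution action of `GL_n(ℂ)` corresponding to `(A,B) ↦ (Agᵀ, Bg⁻¹)`
preserves the null-cone ideal `J`, hence induces an action on `R/J`; and the
subring of `GL_n(ℂ)`-invariants of `R/J` is an integrally closed integral domain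
(the closure of the lifted orbit `θ({0})` is a normal variety). -/
theorem invariants_of_nullcone_normal (p q n : ℕ) (hp : 0 < p) (hq : 0 < q)
    (hn : 0 < n) (h1 : 2 * n < p) (h2 : 2 * n < q) :
    (∀ (g : GL (Fin n) ℂ) (r : MvPolynomial ((Fin p × Fin n) ⊕ (Fin q × Fin n)) ℂ),
        r ∈ nullConeIdealOSp p q n → glSubstAction p q n g r ∈ nullConeIdealOSp p q n) ∧
      ∀ bar : GL (Fin n) ℂ →
          ((MvPolynomial ((Fin p × Fin n) ⊕ (Fin q × Fin n)) ℂ ⧸ nullConeIdealOSp p q n)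
            →ₐ[ℂ]
           (MvPolynomial ((Fin p × Fin n) ⊕ (Fin q × Fin n)) ℂ ⧸ nullConeIdealOSp p q n)),
        (∀ (g : GL (Fin n) ℂ) (x : MvPolynomial ((Fin p × Fin n) ⊕ (Fin q × Fin n)) ℂ),
          bar g (Ideal.Quotient.mk (nullConeIdealOSp p q n) x) =
            Ideal.Quotient.mk (nullConeIdealOSp p q n) (glSubstAction p q n g x)) →
        IsDomain (fixedSubalgebra n bar) ∧ IsIntegrallyClosed (fixedSubalgebra n bar) := by
  obtain ⟨_, _⟩ := nullConeRing_normal h1 h2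
  exact ⟨glSubstAction_mem, fun bar _ => fixedSubalgebra_normal n bar⟩
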